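/- arXiv:1408.6128 — 2 statements merged into one kernel-verified Lean document; each statement's English description precedes it below -/
import Mathlib

section
/- Let κ, λ, L, K > 0, p ≥ 1, g ∈ ℓ², let A be the operator (Ax)_i = -x_{i-1} + 2x_i - x_{i+1} on ℓ², and let f : ℓ² → ℓ² be continuously (Fréchet) differentiable with ⟨x-y, f(x)-f(y)⟩ ≤ -L‖x-y‖² for all x, y ∈ ℓ² and ‖f(x)‖ + ‖Df(x)‖ ≤ K(1+‖x‖^p) for all x ∈ ℓ². Then for every u₀ ∈ ℓ² and every continuous W : [0,∞) → ℓ² with W(0) = 0, there exists a unique continuous function u : [0,∞) → ℓ² such that u(t) = u₀ + ∫₀ᵗ (-κ A u(s) - λ u(s) + f(u(s)) + g) ds + W(t) for all t ≥ 0. -/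
open scoped InnerProductSpace
open Set MeasureTheory

/-- ℓ² of real sequences indexed by ℤ. -/
local notation "ℓ2" => lp (fun _ : ℤ => ℝ) 2

section DissipativeEquation

variable {E : Type*} [NormedAddCommGroup E] [InnerProductSpace ℝ E]

/-- Radial retraction of a normed space onto the closed ball of radius `R`. -/
noncomputable def radialRetraction (R : ℝ) (x : E) : E := (R / max R ‖x‖) • x

lemma radialRetraction_of_norm_le {R : ℝ} (hR : 0 < R) {x : E} (hx : ‖x‖ ≤ R) :
    radialRetraction R x = x := by
  simp [radialRetraction, max_eq_left hx, hR.ne']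

lemma norm_radialRetraction_le {R : ℝ} (hR : 0 < R) (x : E) : ‖radialRetraction R x‖ ≤ R := by
  have h : 0 < max R ‖x‖ := hR.trans_le (le_max_left _ _)
  rw [radialRetraction, norm_smul, Real.norm_of_nonneg (by positivity), div_mul_eq_mul_div,
    div_le_iff₀ h]
  exact mul_le_mul_of_nonneg_left (le_max_right _ _) hR.le

lemma lipschitzWith_radialRetraction {R : ℝ} (hR : 0 < R) :
    LipschitzWith 2 (radialRetraction R : E → E) := by
  refine LipschitzWith.of_dist_le_mul fun x y => ?_
  rw [dist_eq_norm, dist_eq_norm]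
  have ha : 0 < max R ‖x‖ := hR.trans_le (le_max_left _ _)
  have hb : 0 < max R ‖y‖ := hR.trans_le (le_max_left _ _)
  have hsplit : radialRetraction R x - radialRetraction R y
      = (R / max R ‖x‖) • (x - y) + (R / max R ‖x‖ - R / max R ‖y‖) • y := by
    simp only [radialRetraction]; module
  have h1 : ‖(R / max R ‖x‖) • (x - y)‖ ≤ ‖x - y‖ := by
    rw [norm_smul, Real.norm_of_nonneg (by positivity)]
    exact mul_le_of_le_one_left (norm_nonneg _) ((div_le_one ha).2 (le_max_left _ _))
  have h2 : ‖(R / max R ‖x‖ - R / max R ‖y‖) • y‖ ≤ ‖x - y‖ := by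
    have h3 : R / max R ‖x‖ - R / max R ‖y‖
        = (R / max R ‖x‖) * ((max R ‖y‖ - max R ‖x‖) / max R ‖y‖) := by
      field_simp
    have h4 : |max R ‖y‖ - max R ‖x‖| ≤ ‖x - y‖ := by
      rw [← norm_neg (x - y), neg_sub]
      exact (abs_max_sub_max_le_max R ‖y‖ R ‖x‖).trans
        (by simpa using abs_norm_sub_norm_le y x)
    rw [norm_smul, h3, Real.norm_eq_abs, abs_mul, abs_div (_ - _), abs_of_pos hb,
      abs_of_pos (div_pos hR ha), mul_assoc]
    refine (mul_le_of_le_one_left (by positivity) ((div_le_one ha).2 (le_max_left _ _))).trans ?_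
    rw [div_mul_eq_mul_div, div_le_iff₀ hb]
    exact mul_le_mul h4 (le_max_right _ _) (norm_nonneg _) (norm_nonneg _)
  rw [hsplit]
  refine (norm_add_le _ _).trans ?_
  push_cast
  linarith

/-- Energy estimate: if `2 ⟪v, v'⟫ ≤ ‖v‖ ^ 2 + C` then `‖v‖ ^ 2 + C` grows at most exponentially. -/
lemma norm_sq_add_le_exp_mul {v v' : ℝ → E} {T C : ℝ} (hv : ContinuousOn v (Icc 0 T))
    (hv' : ∀ t ∈ Ioo 0 T, HasDerivAt v (v' t) t)
    (hle : ∀ t ∈ Ioo 0 T, 2 * ⟪v t, v' t⟫_ℝ ≤ ‖v t‖ ^ 2 + C) {t : ℝ} (ht : t ∈ Icc 0 T) :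
    ‖v t‖ ^ 2 + C ≤ Real.exp t * (‖v 0‖ ^ 2 + C) := by
  have hderiv : ∀ s ∈ Ioo 0 T, HasDerivAt (fun s => Real.exp (-s) * (‖v s‖ ^ 2 + C))
      (Real.exp (-s) * -1 * (‖v s‖ ^ 2 + C) + Real.exp (-s) * (2 * ⟪v s, v' s⟫_ℝ)) s :=
    fun s hs => (hasDerivAt_neg s).exp.mul ((hv' s hs).norm_sq.add_const C)
  have hanti : AntitoneOn (fun s => Real.exp (-s) * (‖v s‖ ^ 2 + C)) (Icc 0 T) := by
    refine antitoneOn_of_deriv_nonpos (convex_Icc 0 T) (by fun_prop) ?_ ?_ <;>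
      rw [interior_Icc]
    · exact fun s hs => (hderiv s hs).differentiableAt.differentiableWithinAt
    · intro s hs
      rw [(hderiv s hs).deriv]
      nlinarith [hle s hs, Real.exp_pos (-s)]
  have h := hanti (left_mem_Icc.2 (ht.1.trans ht.2)) ht ht.1
  simp only [neg_zero, Real.exp_zero, one_mul] at h
  calc ‖v t‖ ^ 2 + C = Real.exp t * (Real.exp (-t) * (‖v t‖ ^ 2 + C)) := by
        rw [← mul_assoc, ← Real.exp_add]; simp
    _ ≤ _ := mul_le_mul_of_nonneg_left h (Real.exp_pos t).le

/-- `u` is a continuous solution on `s` of `u t = u₀ + ∫₀ᵗ F (u r) dr + W t`. -/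
def IsAdditiveSolutionOn (F : E → E) (u₀ : E) (W u : ℝ → E) (s : Set ℝ) : Prop :=
  ContinuousOn u s ∧ ∀ t ∈ s, u t = u₀ + (∫ r in (0 : ℝ)..t, F (u r)) + W t

lemma IsAdditiveSolutionOn.mono {F : E → E} {u₀ : E} {W u : ℝ → E} {s s' : Set ℝ}
    (h : IsAdditiveSolutionOn F u₀ W u s) (hs : s' ⊆ s) : IsAdditiveSolutionOn F u₀ W u s' :=
  ⟨h.1.mono hs, fun t ht => h.2 t (hs ht)⟩

variable [CompleteSpace E]

lemma IsAdditiveSolutionOn.eqOn_Icc {F : E → E} (hF : Continuous F)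
    (hdiss : ∀ x y, ⟪x - y, F x - F y⟫_ℝ ≤ 0) {u₀ : E} {W u u' : ℝ → E} {T : ℝ}
    (hu : IsAdditiveSolutionOn F u₀ W u (Icc 0 T))
    (hu' : IsAdditiveSolutionOn F u₀ W u' (Icc 0 T)) : EqOn u u' (Icc 0 T) := by
  intro t ht
  have h0 : (0 : ℝ) ∈ Icc 0 T := left_mem_Icc.2 (ht.1.trans ht.2)
  have key : ∀ w, IsAdditiveSolutionOn F u₀ W w (Icc 0 T) → ∀ s ∈ Icc 0 T,
      HasDerivWithinAt (ODE.picard (fun _ => F) 0 u₀ w) (F (w s)) (Icc 0 T) s := fun w hw s hs =>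
    ODE.hasDerivWithinAt_picard_Icc (u := univ) (f := fun _ => F) h0 (by fun_prop) hw.1
      (fun _ _ => mem_univ _) u₀ hs
  have hsub : ∀ s ∈ Icc 0 T, u s - u' s
      = ODE.picard (fun _ => F) 0 u₀ u s - ODE.picard (fun _ => F) 0 u₀ u' s := by
    intro s hs
    rw [hu.2 s hs, hu'.2 s hs, ODE.picard_apply, ODE.picard_apply]
    abel
  have hderiv : ∀ s ∈ Ioo 0 T, HasDerivAt (fun s => u s - u' s) (F (u s) - F (u' s)) s := by
    intro s hs
    have hs' := Ioo_subset_Icc_self hs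
    exact (((key u hu s hs').sub (key u' hu' s hs')).congr_of_mem (fun r hr => hsub r hr)
      hs').hasDerivAt (Icc_mem_nhds hs.1 hs.2)
  have h := norm_sq_add_le_exp_mul (C := 0) (v := fun s => u s - u' s) (hu.1.sub hu'.1) hderiv
    (fun s _ => by nlinarith [hdiss (u s) (u' s), sq_nonneg ‖u s - u' s‖]) ht
  have hz : u 0 - u' 0 = 0 := by rw [hu.2 0 h0, hu'.2 0 h0]; simp
  simp only [hz, norm_zero, add_zero, ne_eq, OfNat.ofNat_ne_zero, not_false_eq_true, zero_pow,
    mul_zero] at h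
  have : ‖u t - u' t‖ = 0 := by
    have := norm_nonneg (u t - u' t)
    nlinarith
  exact sub_eq_zero.1 (norm_eq_zero.1 this)

lemma exists_isAdditiveSolutionOn_Icc {F : E → E}
    (hF : ∀ R : ℝ, ∃ C : NNReal, LipschitzOnWith C F (Metric.closedBall 0 R)) (hFc : Continuous F)
    (hdiss : ∀ x y, ⟪x - y, F x - F y⟫_ℝ ≤ 0) (u₀ : E) {W : ℝ → E} {T : ℝ} (hT : 0 ≤ T)
    (hW : ContinuousOn W (Icc 0 T)) :
    ∃ u, IsAdditiveSolutionOn F u₀ W u (Icc 0 T) := by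
  have h0 : (0 : ℝ) ∈ Icc 0 T := left_mem_Icc.2 hT
  obtain ⟨M, hM⟩ := isCompact_Icc.exists_bound_of_continuousOn hW
  obtain ⟨D, hD⟩ := isCompact_Icc.exists_bound_of_continuousOn (hFc.comp_continuousOn hW)
  have hD0 : 0 ≤ D := (norm_nonneg _).trans (hD 0 h0)
  set R : ℝ := Real.exp T * (‖u₀‖ ^ 2 + D ^ 2) + 1 with hRdef
  have hR : 0 < R := by positivity
  obtain ⟨C, hC⟩ := hF (R + M)
  have hmem : ∀ t ∈ Icc 0 T, ∀ x, radialRetraction R x + W t ∈ Metric.closedBall 0 (R + M) :=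
    fun t ht x => by
      rw [mem_closedBall_zero_iff]
      exact norm_add_le_of_le (norm_radialRetraction_le hR x) (hM t ht)
  have hbound : ∃ B : NNReal, ∀ x ∈ Metric.closedBall (0 : E) (R + M), ‖F x‖ ≤ B := by
    refine ⟨‖F 0‖₊ + C * (R + M).toNNReal, fun x hx => ?_⟩
    have hx' := mem_closedBall_zero_iff.1 hx
    have hRM : 0 ≤ R + M := (norm_nonneg _).trans hx'
    have h1 := hC.norm_sub_le hx (Metric.mem_closedBall_self hRM)
    rw [sub_zero] at h1
    have h2 := norm_le_norm_add_norm_sub' (F x) (F 0)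
    push_cast
    rw [Real.coe_toNNReal _ hRM]
    nlinarith [C.coe_nonneg, mul_le_mul_of_nonneg_left hx' C.coe_nonneg]
  obtain ⟨B, hB⟩ := hbound
  have hPL : IsPicardLindelof (fun t x => F (radialRetraction R x + W t))
      (⟨0, h0⟩ : Icc 0 T) u₀ (B * T.toNNReal) 0 B (C * 2) := by
    refine ⟨fun t ht => ?_, fun x _ => ?_, fun t ht x _ => hB _ (hmem t ht x), ?_⟩
    · refine LipschitzOnWith.of_dist_le_mul fun x _ y _ => ?_
      have h1 := hC.dist_le_mul _ (hmem t ht x) _ (hmem t ht y)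
      have h2 := (lipschitzWith_radialRetraction hR).dist_le_mul x y
      rw [dist_add_right] at h1
      push_cast at h2 ⊢
      rw [mul_assoc]
      exact h1.trans (mul_le_mul_of_nonneg_left h2 C.coe_nonneg)
    · exact hFc.comp_continuousOn (continuousOn_const.add hW)
    · simp [hT]
  obtain ⟨v, hv0, hv⟩ := hPL.exists_eq_forall_mem_Icc_hasDerivWithinAt₀
  have hvc : ContinuousOn v (Icc 0 T) := fun t ht => (hv t ht).continuousWithinAt
  have hvd : ∀ t ∈ Ioo 0 T, HasDerivAt v (F (radialRetraction R (v t) + W t)) t :=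
    fun t ht => (hv t (Ioo_subset_Icc_self ht)).hasDerivAt (Icc_mem_nhds ht.1 ht.2)
  have hvR : ∀ t ∈ Icc 0 T, ‖v t‖ ≤ R := by
    intro t ht
    have h := norm_sq_add_le_exp_mul (C := D ^ 2) hvc hvd (fun s hs => ?_) ht
    · have hexp : Real.exp t ≤ Real.exp T := Real.exp_le_exp.2 ht.2
      have h1 : ‖v t‖ ^ 2 + D ^ 2 ≤ Real.exp T * (‖u₀‖ ^ 2 + D ^ 2) := by
        refine h.trans ?_
        rw [show v 0 = u₀ from hv0]
        gcongr
      nlinarith [sq_nonneg (‖v t‖ - 1), sq_nonneg D, norm_nonneg (v t)]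
    · have hc : 0 < R / max R ‖v s‖ := div_pos hR (hR.trans_le (le_max_left _ _))
      have h1 := hdiss (radialRetraction R (v s) + W s) (W s)
      rw [add_sub_cancel_right] at h1
      nth_rewrite 1 [radialRetraction] at h1
      rw [real_inner_smul_left] at h1
      have h2 := nonpos_of_mul_nonpos_right h1 hc
      rw [inner_sub_right] at h2
      have h3 := real_inner_le_norm (v s) (F (W s))
      have h4 := mul_le_mul_of_nonneg_left (hD s (Ioo_subset_Icc_self hs)) (norm_nonneg (v s))
      simp only [Function.comp_apply] at h4
      nlinarith [sq_nonneg (‖v s‖ - D)]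
  refine ⟨fun t => v t + W t, hvc.add hW, fun t ht => ?_⟩
  have hsub : Icc 0 t ⊆ Icc 0 T := Icc_subset_Icc_right ht.2
  have hint : ∫ r in (0 : ℝ)..t, F (v r + W r) = v t - v 0 := by
    refine intervalIntegral.integral_eq_sub_of_hasDerivAt_of_le ht.1 (hvc.mono hsub)
      (fun s hs => ?_) ?_
    · have hs' : s ∈ Ioo 0 T := ⟨hs.1, hs.2.trans_le ht.2⟩
      have := hvd s hs'
      rwa [radialRetraction_of_norm_le hR (hvR s (Ioo_subset_Icc_self hs'))] at this
    · refine ContinuousOn.intervalIntegrable ?_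
      rw [uIcc_of_le ht.1]
      exact (hFc.comp_continuousOn (hvc.add hW)).mono hsub
  rw [hint, show v 0 = u₀ from hv0, add_sub_cancel]

theorem exists_isAdditiveSolutionOn_Ici {F : E → E}
    (hF : ∀ R : ℝ, ∃ C : NNReal, LipschitzOnWith C F (Metric.closedBall 0 R)) (hFc : Continuous F)
    (hdiss : ∀ x y, ⟪x - y, F x - F y⟫_ℝ ≤ 0) (u₀ : E) {W : ℝ → E}
    (hW : ContinuousOn W (Ici 0)) :
    ∃ u, IsAdditiveSolutionOn F u₀ W u (Ici 0) := by
  have hex : ∀ T : ℝ, ∃ u, 0 ≤ T → IsAdditiveSolutionOn F u₀ W u (Icc 0 T) := fun T => by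
    by_cases hT : 0 ≤ T
    · obtain ⟨u, hu⟩ := exists_isAdditiveSolutionOn_Icc hF hFc hdiss u₀ hT
        (hW.mono Icc_subset_Ici_self)
      exact ⟨u, fun _ => hu⟩
    · exact ⟨0, fun h => absurd h hT⟩
  choose w hw using hex
  have heq : ∀ T, 0 ≤ T → EqOn (fun t => w t t) (w T) (Icc 0 T) := fun T hT t ht =>
    (hw t ht.1).eqOn_Icc hFc hdiss ((hw T hT).mono (Icc_subset_Icc_right ht.2))
      (right_mem_Icc.2 ht.1)
  refine ⟨fun t => w t t, fun t ht => ?_, fun t ht => ?_⟩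
  · have ht0 : (0 : ℝ) ≤ t := ht
    have hT : 0 ≤ t + 1 := by positivity
    have hc := ((hw _ hT).1.congr (heq _ hT)) t ⟨ht0, by linarith⟩
    refine hc.mono_of_mem_nhdsWithin ?_
    rw [← Ici_inter_Iic]
    exact Filter.inter_mem self_mem_nhdsWithin (mem_nhdsWithin_of_mem_nhds (Iic_mem_nhds (by linarith)))
  · have ht0 : (0 : ℝ) ≤ t := ht
    have hcongr : ∫ r in (0 : ℝ)..t, F (w r r) = ∫ r in (0 : ℝ)..t, F (w t r) := by
      refine intervalIntegral.integral_congr fun r hr => ?_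
      rw [uIcc_of_le ht0] at hr
      exact congrArg F (heq t ht0 hr)
    rw [hcongr]
    exact (hw t ht0).2 t (right_mem_Icc.2 ht0)

end DissipativeEquation

lemma lipschitzOnWith_closedBall_of_fderiv_growth {E G : Type*} [NormedAddCommGroup E]
    [NormedSpace ℝ E] [NormedAddCommGroup G] [NormedSpace ℝ G] {f : E → G} {K p : ℝ} (hK : 0 ≤ K)
    (hp : 0 ≤ p) (hf : Differentiable ℝ f) (hgrowth : ∀ x, ‖fderiv ℝ f x‖ ≤ K * (1 + ‖x‖ ^ p))
    (R : ℝ) : ∃ C : NNReal, LipschitzOnWith C f (Metric.closedBall 0 R) := by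
  refine ⟨(K * (1 + R ^ p)).toNNReal, (convex_closedBall 0 R).lipschitzOnWith_of_nnnorm_fderiv_le
    (fun x _ => hf x) fun x hx => ?_⟩
  rw [← norm_toNNReal]
  refine Real.toNNReal_le_toNNReal ((hgrowth x).trans ?_)
  have := Real.rpow_le_rpow (norm_nonneg x) (mem_closedBall_zero_iff.1 hx) hp
  gcongr

/-- Reindexing a square-summable sequence by a permutation preserves the norm. -/
lemma exists_norm_eq_forall_eq_comp (e : ℤ ≃ ℤ) (x : lp (fun _ : ℤ => ℝ) 2) :
    ∃ y : lp (fun _ : ℤ => ℝ) 2, ‖y‖ = ‖x‖ ∧ ∀ i, y i = x (e i) := by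
  have h2 : 0 < (2 : ENNReal).toReal := by norm_num
  have hsum : Summable fun i => ‖x i‖ ^ (2 : ENNReal).toReal :=
    (memℓp_gen_iff h2).1 (lp.memℓp x)
  refine ⟨⟨fun i => x (e i), memℓp_gen (e.summable_iff.2 hsum)⟩, ?_, fun _ => rfl⟩
  rw [lp.norm_eq_tsum_rpow h2, lp.norm_eq_tsum_rpow h2]
  congr 1
  exact e.tsum_eq fun i => ‖x i‖ ^ (2 : ENNReal).toReal

section DiscreteLaplacian

variable {A : lp (fun _ : ℤ => ℝ) 2 → lp (fun _ : ℤ => ℝ) 2}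

lemma exists_discreteLaplacian_eq
    (hA : ∀ (x : lp (fun _ : ℤ => ℝ) 2) (i : ℤ), A x i = -x (i - 1) + 2 * x i - x (i + 1))
    (x : lp (fun _ : ℤ => ℝ) 2) :
    ∃ y z : lp (fun _ : ℤ => ℝ) 2, ‖y‖ = ‖x‖ ∧ ‖z‖ = ‖x‖ ∧ A x = (2 : ℝ) • x - y - z := by
  obtain ⟨y, hy, hyx⟩ := exists_norm_eq_forall_eq_comp (Equiv.subRight 1) x
  obtain ⟨z, hz, hzx⟩ := exists_norm_eq_forall_eq_comp (Equiv.addRight 1) x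
  refine ⟨y, z, hy, hz, lp.ext (funext fun i => ?_)⟩
  simp only [hA, lp.coeFn_sub, lp.coeFn_smul, Pi.sub_apply, Pi.smul_apply, smul_eq_mul, hyx, hzx,
    Equiv.subRight_apply, Equiv.coe_addRight]
  ring

lemma norm_discreteLaplacian_le
    (hA : ∀ (x : lp (fun _ : ℤ => ℝ) 2) (i : ℤ), A x i = -x (i - 1) + 2 * x i - x (i + 1))
    (x : lp (fun _ : ℤ => ℝ) 2) : ‖A x‖ ≤ 4 * ‖x‖ := by
  obtain ⟨y, z, hy, hz, h⟩ := exists_discreteLaplacian_eq hA x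
  have h1 := norm_sub_le ((2 : ℝ) • x - y) z
  have h2 := norm_sub_le ((2 : ℝ) • x) y
  rw [norm_smul, Real.norm_of_nonneg zero_le_two] at h2
  rw [h]
  linarith

lemma inner_discreteLaplacian_nonneg
    (hA : ∀ (x : lp (fun _ : ℤ => ℝ) 2) (i : ℤ), A x i = -x (i - 1) + 2 * x i - x (i + 1))
    (x : lp (fun _ : ℤ => ℝ) 2) : 0 ≤ ⟪x, A x⟫_ℝ := by
  obtain ⟨y, z, hy, hz, h⟩ := exists_discreteLaplacian_eq hA x
  have h1 := real_inner_le_norm x y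
  have h2 := real_inner_le_norm x z
  rw [hy] at h1
  rw [hz] at h2
  rw [h, inner_sub_right, inner_sub_right, real_inner_smul_right, real_inner_self_eq_norm_mul_norm]
  linarith

lemma discreteLaplacian_sub
    (hA : ∀ (x : lp (fun _ : ℤ => ℝ) 2) (i : ℤ), A x i = -x (i - 1) + 2 * x i - x (i + 1))
    (x y : lp (fun _ : ℤ => ℝ) 2) : A (x - y) = A x - A y := by
  refine lp.ext (funext fun i => ?_)
  simp only [hA, lp.coeFn_sub, Pi.sub_apply]
  ring

lemma lipschitzWith_discreteLaplacian
    (hA : ∀ (x : lp (fun _ : ℤ => ℝ) 2) (i : ℤ), A x i = -x (i - 1) + 2 * x i - x (i + 1)) :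
    LipschitzWith 4 A := by
  refine LipschitzWith.of_dist_le_mul fun x y => ?_
  rw [dist_eq_norm, dist_eq_norm, ← discreteLaplacian_sub hA]
  exact norm_discreteLaplacian_le hA _

end DiscreteLaplacian

/-- pathwise existence and uniqueness.  Under the dissipativity,
C¹-smoothness and polynomial growth conditions on f, for every u₀ ∈ ℓ² and every
continuous path W with W(0)=0 there exists a unique continuous u : [0,∞) → ℓ²
solving u(t) = u₀ + ∫₀ᵗ (-κAu - λu + f(u) + g) ds + W(t). -/
theorem stmt9 (A : ℓ2 → ℓ2)
    (hA : ∀ (x : ℓ2) (i : ℤ), A x i = -x (i - 1) + 2 * x i - x (i + 1))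
    (κ lam L K p : ℝ) (hκ : 0 < κ) (hlam : 0 < lam) (hL : 0 < L) (hK : 0 < K)
    (hp : 1 ≤ p) (g : ℓ2) (f : ℓ2 → ℓ2) (hf : ContDiff ℝ 1 f)
    (hdiss : ∀ x y : ℓ2, ⟪x - y, f x - f y⟫_ℝ ≤ -L * ‖x - y‖ ^ 2)
    (hgrowth : ∀ x : ℓ2, ‖f x‖ + ‖fderiv ℝ f x‖ ≤ K * (1 + ‖x‖ ^ p))
    (u₀ : ℓ2) (W : ℝ → ℓ2) (hW : ContinuousOn W (Ici 0)) (hW0 : W 0 = 0) :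
    ∃ u : ℝ → ℓ2,
      (ContinuousOn u (Ici 0) ∧
        ∀ t ∈ Ici (0:ℝ),
          u t = u₀ + (∫ s in (0:ℝ)..t, (-(κ • A (u s)) - lam • u s + f (u s) + g))
            + W t) ∧
      ∀ u' : ℝ → ℓ2,
        (ContinuousOn u' (Ici 0) ∧
          ∀ t ∈ Ici (0:ℝ),
            u' t = u₀ + (∫ s in (0:ℝ)..t, (-(κ • A (u' s)) - lam • u' s + f (u' s) + g))
              + W t) →
        ∀ t ∈ Ici (0:ℝ), u' t = u t := by
  set F : ℓ2 → ℓ2 := fun x => -(κ • A x) - lam • x + f x + g with hFdef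
  have hAL := lipschitzWith_discreteLaplacian hA
  have hAc := hAL.continuous
  have hfc := hf.continuous
  have hFc : Continuous F := by fun_prop
  have hFL : ∀ R : ℝ, ∃ C : NNReal, LipschitzOnWith C F (Metric.closedBall 0 R) := by
    intro R
    obtain ⟨C, hC⟩ := lipschitzOnWith_closedBall_of_fderiv_growth hK.le (zero_le_one.trans hp)
      (hf.differentiable one_ne_zero)
      (fun x => (le_add_of_nonneg_left (norm_nonneg _)).trans (hgrowth x)) R
    have h1 := ((lipschitzWith_smul κ).comp hAL).neg.lipschitzOnWith (s := Metric.closedBall 0 R)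
    have h2 := (lipschitzWith_smul (β := ℓ2) lam).lipschitzOnWith (s := Metric.closedBall 0 R)
    exact ⟨_, ((h1.sub h2).add hC).add (LipschitzWith.const g).lipschitzOnWith⟩
  have hFd : ∀ x y, ⟪x - y, F x - F y⟫_ℝ ≤ 0 := by
    intro x y
    have h : F x - F y = -(κ • A (x - y)) - lam • (x - y) + (f x - f y) := by
      rw [discreteLaplacian_sub hA]
      simp only [hFdef, smul_sub]
      abel
    rw [h, inner_add_right, inner_sub_right, inner_neg_right, real_inner_smul_right,
      real_inner_smul_right, real_inner_self_eq_norm_sq]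
    have h1 := mul_nonneg hκ.le (inner_discreteLaplacian_nonneg hA (x - y))
    have h2 := mul_nonneg hlam.le (sq_nonneg ‖x - y‖)
    have h3 := mul_nonneg hL.le (sq_nonneg ‖x - y‖)
    linarith [hdiss x y]
  obtain ⟨u, hu⟩ := exists_isAdditiveSolutionOn_Ici hFL hFc hFd u₀ hW
  refine ⟨u, hu, fun u' hu' t ht => ?_⟩
  have hu'' : IsAdditiveSolutionOn F u₀ W u' (Ici 0) := hu'
  exact (hu''.mono Icc_subset_Ici_self).eqOn_Icc hFc hFd (hu.mono Icc_subset_Ici_self)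
    (right_mem_Icc.2 ht)
end

section
/- Let λ > 0, ρ > 0, let E be a real Banach space, and let W : ℝ → E be continuous with ‖W(s)‖ ≤ ρ(1 + s²) for all s ∈ ℝ. Then for every t ∈ ℝ the function s ↦ e^{-λ(t-s)} W(s) is Bochner integrable on (-∞, t], so that ū(t) := W(t) - λ ∫_{-∞}^t e^{-λ(t-s)} W(s) ds is well defined, and there is a constant C > 0 depending only on λ such that ‖ū(t)‖ ≤ C ρ (1 + |t|)² for all t ∈ ℝ; in fact one may take C = 2(1 + 1/λ + 1/λ²). -/
open Set MeasureTheory Real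

/-- A nonnegative continuous function with a nonnegative antiderivative `F` is integrable on
`(-∞, t]`, with integral at most `F t`. -/
theorem integrableOn_Iic_and_integral_le_of_hasDerivAt_of_nonneg {F f : ℝ → ℝ}
    (hF : ∀ s, HasDerivAt F (f s) s) (hf : Continuous f) (hf0 : ∀ s, 0 ≤ f s)
    (hF0 : ∀ s, 0 ≤ F s) (t : ℝ) :
    IntegrableOn f (Iic t) ∧ ∫ s in Iic t, f s ≤ F t := by
  have hle : ∀ a, ∫ s in a..t, f s ≤ F t := fun a => by
    rw [intervalIntegral.integral_eq_sub_of_hasDerivAt (fun s _ => hF s)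
      (hf.intervalIntegrable a t)]
    linarith [hF0 a]
  have hint : IntegrableOn f (Iic t) := by
    refine integrableOn_Iic_of_intervalIntegral_norm_bounded (a := fun a : ℝ => a)
      (l := Filter.atBot) (F t) t
      (fun a => (hf.integrableOn_Icc (a := a) (b := t)).mono_set Ioc_subset_Icc_self)
      Filter.tendsto_id (Filter.Eventually.of_forall fun a => ?_)
    simpa only [norm_of_nonneg (hf0 _)] using hle a
  exact ⟨hint, le_of_tendsto (intervalIntegral_tendsto_integral_Iic t hint Filter.tendsto_id)
    (Filter.Eventually.of_forall hle)⟩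

theorem hasDerivAt_exp_mul_quadratic {lam : ℝ} (hlam : lam ≠ 0) (t s : ℝ) :
    HasDerivAt
      (fun s => exp (-lam * (t - s)) * ((1 + s ^ 2) / lam - 2 * s / lam ^ 2 + 2 / lam ^ 3))
      (exp (-lam * (t - s)) * (1 + s ^ 2)) s := by
  have hexp : HasDerivAt (fun s => exp (-lam * (t - s))) (exp (-lam * (t - s)) * lam) s := by
    simpa using (((hasDerivAt_id s).const_sub t).const_mul (-lam)).exp
  have hpoly : HasDerivAt (fun s : ℝ => (1 + s ^ 2) / lam - 2 * s / lam ^ 2 + 2 / lam ^ 3)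
      (2 * s / lam - 2 / lam ^ 2) s := by
    simpa using (((((hasDerivAt_id s).pow 2).const_add 1).div_const lam).sub
      (((hasDerivAt_id s).const_mul 2).div_const (lam ^ 2))).add_const (2 / lam ^ 3)
  refine (hexp.mul hpoly).congr_deriv ?_
  field_simp
  ring

theorem integrableOn_and_integral_exp_mul_one_add_sq_le {lam : ℝ} (hlam : 0 < lam) (t : ℝ) :
    IntegrableOn (fun s => exp (-lam * (t - s)) * (1 + s ^ 2)) (Iic t) ∧
      ∫ s in Iic t, exp (-lam * (t - s)) * (1 + s ^ 2) ≤
        (1 + t ^ 2) / lam - 2 * t / lam ^ 2 + 2 / lam ^ 3 := by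
  have h := integrableOn_Iic_and_integral_le_of_hasDerivAt_of_nonneg
    (hasDerivAt_exp_mul_quadratic hlam.ne' t) (by fun_prop) (fun s => by positivity)
    (fun s => by
      have hsq : (1 + s ^ 2) / lam - 2 * s / lam ^ 2 + 2 / lam ^ 3 =
          (1 + (s - 1 / lam) ^ 2 + (1 / lam) ^ 2) / lam := by
        field_simp
        ring
      rw [hsq]
      positivity) t
  simpa using h

/-- for a continuous path W : ℝ → E with ‖W(s)‖ ≤ ρ(1+s²), the function
s ↦ e^{-λ(t-s)}W(s) is Bochner integrable on (-∞, t], so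
ū(t) = W(t) - λ∫_{-∞}^t e^{-λ(t-s)}W(s) ds is well defined, and
‖ū(t)‖ ≤ Cρ(1+|t|)² with C = 2(1 + 1/λ + 1/λ²). -/
theorem stmt13 {E : Type*} [NormedAddCommGroup E] [NormedSpace ℝ E] [CompleteSpace E]
    (lam ρ : ℝ) (hlam : 0 < lam) (hρ : 0 < ρ)
    (W : ℝ → E) (hW : Continuous W) (hWbd : ∀ s : ℝ, ‖W s‖ ≤ ρ * (1 + s ^ 2)) :
    ∃ C : ℝ, 0 < C ∧ C = 2 * (1 + 1 / lam + 1 / lam ^ 2) ∧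
      ∀ t : ℝ,
        IntegrableOn (fun s => exp (-lam * (t - s)) • W s) (Iic t) volume ∧
        ‖W t - lam • (∫ s in Iic t, exp (-lam * (t - s)) • W s)‖
          ≤ C * ρ * (1 + |t|) ^ 2 := by
  refine ⟨2 * (1 + 1 / lam + 1 / lam ^ 2), by positivity, rfl, fun t => ?_⟩
  obtain ⟨hint, hle⟩ := integrableOn_and_integral_exp_mul_one_add_sq_le hlam t
  have hbd : ∀ s, ‖exp (-lam * (t - s)) • W s‖ ≤
      ρ * (exp (-lam * (t - s)) * (1 + s ^ 2)) := fun s => by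
    rw [norm_smul, norm_of_nonneg (exp_pos _).le, mul_left_comm]
    exact mul_le_mul_of_nonneg_left (hWbd s) (exp_pos _).le
  have hcont : Continuous fun s => exp (-lam * (t - s)) • W s := by fun_prop
  refine ⟨(hint.const_mul ρ).mono' hcont.aestronglyMeasurable (.of_forall hbd), ?_⟩
  have hnorm : ‖∫ s in Iic t, exp (-lam * (t - s)) • W s‖ ≤
      ρ * ((1 + t ^ 2) / lam - 2 * t / lam ^ 2 + 2 / lam ^ 3) := by
    refine (norm_integral_le_of_norm_le (hint.const_mul ρ) (.of_forall hbd)).trans ?_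
    rw [integral_const_mul]
    exact mul_le_mul_of_nonneg_left hle hρ.le
  calc ‖W t - lam • ∫ s in Iic t, exp (-lam * (t - s)) • W s‖
      ≤ ‖W t‖ + lam * ‖∫ s in Iic t, exp (-lam * (t - s)) • W s‖ := by
        simpa only [norm_smul, norm_of_nonneg hlam.le] using
          norm_sub_le (W t) (lam • ∫ s in Iic t, exp (-lam * (t - s)) • W s)
    _ ≤ ρ * (1 + t ^ 2) + lam * (ρ * ((1 + t ^ 2) / lam - 2 * t / lam ^ 2 + 2 / lam ^ 3)) :=
        add_le_add (hWbd t) (mul_le_mul_of_nonneg_left hnorm hlam.le)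
    _ = ρ * (2 * (1 + t ^ 2) - 2 * (1 / lam) * t + 2 * (1 / lam ^ 2)) := by
        field_simp
        ring
    _ ≤ ρ * (2 * (1 + 1 / lam + 1 / lam ^ 2) * (1 + |t|) ^ 2) := by
        refine mul_le_mul_of_nonneg_left ?_ hρ.le
        have hone : 1 ≤ (1 + |t|) ^ 2 := by nlinarith [abs_nonneg t]
        have hneg : -t ≤ (1 + |t|) ^ 2 := by nlinarith [abs_nonneg t, neg_abs_le t]
        have hsq : 1 + t ^ 2 ≤ (1 + |t|) ^ 2 := by nlinarith [abs_nonneg t, sq_abs t]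
        have h₁ := mul_le_mul_of_nonneg_left hneg (by positivity : 0 ≤ 1 / lam)
        have h₂ := mul_le_mul_of_nonneg_left hone (by positivity : 0 ≤ 1 / lam ^ 2)
        linarith
    _ = 2 * (1 + 1 / lam + 1 / lam ^ 2) * ρ * (1 + |t|) ^ 2 := by ring
end
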